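/- Let φ ∈ C(S×P) be such that ∫_{S×P} φ dλ = Σ(ν,φ) for every Q_ν-invariant Borel probability measure λ. Then for every ε > 0 there exist constants C₃ = C₃(ν,φ,ε) > 0 and c₃ = c₃(ν,φ,ε) > 0 such that for every [v] ∈ P and every N ∈ ℕ there exists a measurable set ℰ₃ ⊂ G^ℕ satisfying: (1) ν^ℕ(ℰ₃^c) ≤ C₃ e^{−c₃N}, and (2) Σ(ν,φ) − ε < (1/n) ∑_{j=0}^{n−1} φ(g_j, (g_j g_{j−1} ⋯ g_0)·[v]) < Σ(ν,φ) + ε for every 𝐠 = (g_0,g_1,…) ∈ ℰ₃ and every n ≥ N. -/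

import Mathlib

open MeasureTheory Filter Topology
open scoped ENNReal

noncomputable section

abbrev Euc (d : ℕ) := EuclideanSpace ℝ (Fin d)
abbrev Md (d : ℕ) := Euc d →L[ℝ] Euc d

/-- The group `G = GL(d,ℝ)`, realized as the group of units of the algebra of linear
endomorphisms of `ℝ^d`. -/
abbrev GLd (d : ℕ) := (Md d)ˣ

/-- The real projective space `P = P(ℝ^d)`. -/
abbrev Pd (d : ℕ) := Projectivization ℝ (Euc d)

instance (d : ℕ) : TopologicalSpace (Pd d) :=
  inferInstanceAs (TopologicalSpace (Quotient (projectivizationSetoid ℝ (Euc d))))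

instance (d : ℕ) : MeasurableSpace (Pd d) := borel _

/-- The projective action of `GL(d,ℝ)` on `P(ℝ^d)`: `g • [v] = [g v]`. -/
def pact {d : ℕ} (g : GLd d) (x : Pd d) : Pd d :=
  Projectivization.map ((g : Md d) : Euc d →ₗ[ℝ] Euc d)
    (by
      have h : Function.LeftInverse (⇑((g⁻¹ : GLd d) : Md d)) (⇑((g : GLd d) : Md d)) := by
        intro v
        have h1 : ((g⁻¹ : GLd d) : Md d) * ((g : GLd d) : Md d) = 1 := g.inv_mul
        calc ((g⁻¹ : GLd d) : Md d) (((g : GLd d) : Md d) v)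
            = (((g⁻¹ : GLd d) : Md d) * ((g : GLd d) : Md d)) v := rfl
          _ = v := by rw [h1]; rfl
      exact h.injective) x

/-- The (topological) support of a measure. -/
def msupport {α : Type*} [TopologicalSpace α] [MeasurableSpace α] (μ : Measure α) : Set α :=
  {x | ∀ u : Set α, IsOpen u → x ∈ u → 0 < μ u}

/-- The measure `ν`, viewed as a measure on its (compact) support `S`. -/
def nuS {d : ℕ} (ν : Measure (GLd d)) : Measure (↥(msupport ν)) :=
  ν.comap Subtype.val

/-- The operator `Q_ν` on functions on `S × P`:
`(Q_ν ψ)(g′, x) = ∫_S ψ(g, g • x) dν(g)` (the value does not depend on `g′`). -/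
def Qop {d : ℕ} (ν : Measure (GLd d)) (ψ : ↥(msupport ν) × Pd d → ℝ) :
    ↥(msupport ν) × Pd d → ℝ :=
  fun p => ∫ g : ↥(msupport ν), ψ (g, pact (g : GLd d) p.2) ∂(nuS ν)

/-- A Borel probability measure `lam` on `S × P` is `Q_ν`-invariant if
`∫ Q_ν ψ dlam = ∫ ψ dlam` for every continuous (bounded) `ψ`. -/
def QInv {d : ℕ} (ν : Measure (GLd d)) (lam : Measure (↥(msupport ν) × Pd d)) : Prop :=
  ∀ ψ : BoundedContinuousFunction (↥(msupport ν) × Pd d) ℝ,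
    ∫ p, Qop ν (⇑ψ) p ∂lam = ∫ p, ψ p ∂lam

/-- `Σ(ν,φ) = sup { ∫ φ dlam : lam a Q_ν-invariant Borel probability measure on S × P }`. -/
def SigmaSup {d : ℕ} (ν : Measure (GLd d))
    (φ : BoundedContinuousFunction (↥(msupport ν) × Pd d) ℝ) : ℝ :=
  sSup {r : ℝ | ∃ lam : Measure (↥(msupport ν) × Pd d),
    IsProbabilityMeasure lam ∧ QInv ν lam ∧ r = ∫ p, φ p ∂lam}



section Projective

variable {d : ℕ}

/-- The quotient map from nonzero vectors to projective space. -/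
def projMk (d : ℕ) (v : {v : Euc d // v ≠ 0}) : Pd d := Projectivization.mk ℝ v.1 v.2

lemma isOpenQuotientMap_projMk : IsOpenQuotientMap (projMk d) := by
  have hq : Topology.IsQuotientMap (projMk d) :=
    isQuotientMap_quotient_mk' (s := projectivizationSetoid ℝ (Euc d))
  refine ⟨hq.surjective, hq.continuous, fun U hU => ?_⟩
  rw [← hq.isOpen_preimage]
  have key : projMk d ⁻¹' (projMk d '' U) =
      ⋃ c : ℝˣ, (fun v : {v : Euc d // v ≠ 0} =>
        (⟨c • v.1, (smul_ne_zero_iff_ne c).2 v.2⟩ : {v : Euc d // v ≠ 0})) ⁻¹' U := by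
    ext v
    simp only [Set.mem_preimage, Set.mem_image, Set.mem_iUnion]
    constructor
    · rintro ⟨u, hu, huv⟩
      obtain ⟨c, hc⟩ := (Projectivization.mk_eq_mk_iff ℝ u.1 v.1 u.2 v.2).1 huv
      exact ⟨c, by simpa only [hc] using hu⟩
    · rintro ⟨c, hc⟩
      exact ⟨_, hc, (Projectivization.mk_eq_mk_iff ℝ _ _ _ _).2 ⟨c, rfl⟩⟩
  rw [key]
  refine isOpen_iUnion fun c => hU.preimage ?_
  exact (continuous_subtype_val.const_smul c).subtype_mk _

instance instT2SpacePd : T2Space (Pd d) := by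
  rw [t2Space_iff_of_isOpenQuotientMap isOpenQuotientMap_projMk]
  have key : {q : {v : Euc d // v ≠ 0} × {v : Euc d // v ≠ 0} | projMk d q.1 = projMk d q.2} =
      {q | ‖inner ℝ q.1.1 q.2.1‖ = ‖q.1.1‖ * ‖q.2.1‖} := by
    ext ⟨v, w⟩
    simp only [Set.mem_ofPred_eq]
    rw [norm_inner_eq_norm_iff v.2 w.2, projMk, projMk, eq_comm,
      Projectivization.mk_eq_mk_iff]
    constructor
    · rintro ⟨c, hc⟩
      exact ⟨c, c.ne_zero, hc.symm⟩
    · rintro ⟨r, hr, h⟩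
      exact ⟨Units.mk0 r hr, h.symm⟩
  rw [key]
  exact isClosed_eq (by fun_prop) (by fun_prop)

instance instSecondCountableTopologyPd : SecondCountableTopology (Pd d) :=
  isOpenQuotientMap_projMk.isQuotientMap.secondCountableTopology
    isOpenQuotientMap_projMk.isOpenMap

instance instCompactSpacePd : CompactSpace (Pd d) := by
  let f : Metric.sphere (0 : Euc d) 1 → Pd d := fun v =>
    projMk d ⟨v.1, ne_zero_of_mem_unit_sphere v⟩
  have hf : Continuous f :=
    isOpenQuotientMap_projMk.continuous.comp (continuous_subtype_val.subtype_mk _)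
  have hs : Function.Surjective f := by
    intro x
    obtain ⟨v, rfl⟩ := isOpenQuotientMap_projMk.surjective x
    have hv : ‖v.1‖ ≠ 0 := norm_ne_zero_iff.2 v.2
    refine ⟨⟨‖v.1‖⁻¹ • v.1, by simp [norm_smul, hv]⟩, ?_⟩
    exact (Projectivization.mk_eq_mk_iff ℝ _ _ _ _).2 ⟨Units.mk0 _ (inv_ne_zero hv), rfl⟩
  exact ⟨by simpa [hs.range_eq] using isCompact_range hf⟩

instance instBorelSpacePd : BorelSpace (Pd d) := ⟨rfl⟩

lemma GLd_apply_ne_zero (g : GLd d) {v : Euc d} (hv : v ≠ 0) : (g : Md d) v ≠ 0 := by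
  intro h
  apply hv
  have h1 : ((g⁻¹ : GLd d) : Md d) * ((g : GLd d) : Md d) = 1 := g.inv_mul
  calc v = (((g⁻¹ : GLd d) : Md d) * ((g : GLd d) : Md d)) v := by rw [h1]; rfl
    _ = ((g⁻¹ : GLd d) : Md d) ((g : Md d) v) := rfl
    _ = 0 := by rw [h, map_zero]

lemma pact_projMk (g : GLd d) (v : {v : Euc d // v ≠ 0}) :
    pact g (projMk d v) = projMk d ⟨(g : Md d) v.1, GLd_apply_ne_zero g v.2⟩ := rfl

lemma pact_one (x : Pd d) : pact (1 : GLd d) x = x := by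
  obtain ⟨v, rfl⟩ := isOpenQuotientMap_projMk.surjective x
  rfl

lemma pact_mul (g h : GLd d) (x : Pd d) : pact (g * h) x = pact g (pact h x) := by
  obtain ⟨v, rfl⟩ := isOpenQuotientMap_projMk.surjective x
  rfl

lemma continuous_pact : Continuous fun p : GLd d × Pd d => pact p.1 p.2 := by
  rw [← (IsOpenQuotientMap.id.prodMap isOpenQuotientMap_projMk).continuous_comp_iff]
  have h : Continuous fun p : GLd d × {v : Euc d // v ≠ 0} => (p.1 : Md d) p.2.1 :=
    (Units.continuous_val.comp continuous_fst).clm_apply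
      (continuous_subtype_val.comp continuous_snd)
  exact isOpenQuotientMap_projMk.continuous.comp
    (h.subtype_mk fun p => GLd_apply_ne_zero p.1 p.2.2)

instance instBorelSpaceGLd : BorelSpace (GLd d) := by
  refine ⟨?_⟩
  rw [Units.isOpenEmbedding_val.isInducing.eq_induced]
  exact borel_comap.symm

instance instSecondCountableTopologyGLd : SecondCountableTopology (GLd d) := by
  have : ProperSpace (Md d) := FiniteDimensional.proper ℝ _
  exact Units.isOpenEmbedding_val.isEmbedding.secondCountableTopology

end Projective

section Support

variable {α : Type*} [TopologicalSpace α] [MeasurableSpace α] (μ : Measure α)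

lemma isClosed_msupport : IsClosed (msupport μ) := by
  rw [← isOpen_compl_iff, isOpen_iff_forall_mem_open]
  intro x hx
  simp only [msupport, Set.mem_compl_iff, Set.mem_ofPred_eq, not_forall] at hx
  obtain ⟨u, hu, hxu, hμ⟩ := hx
  exact ⟨u, fun y hy hys => hμ (hys u hu hy), hu, hxu⟩

lemma measure_compl_msupport [SecondCountableTopology α] : μ (msupport μ)ᶜ = 0 := by
  refine measure_null_of_locally_null _ fun x hx => ?_
  simp only [msupport, Set.mem_compl_iff, Set.mem_ofPred_eq, not_forall] at hx
  obtain ⟨u, hu, hxu, hμ⟩ := hx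
  exact ⟨u, mem_nhdsWithin_of_mem_nhds (hu.mem_nhds hxu), by simpa using hμ⟩

end Support

lemma isProbabilityMeasure_nuS {d : ℕ} (ν : Measure (GLd d)) [IsProbabilityMeasure ν] :
    IsProbabilityMeasure (nuS ν) := by
  have hm : MeasurableSet (msupport ν) := (isClosed_msupport ν).measurableSet
  refine ⟨?_⟩
  rw [nuS, (MeasurableEmbedding.subtype_coe hm).comap_apply, Set.image_univ, Subtype.range_coe]
  exact (prob_compl_eq_zero_iff hm).1 (measure_compl_msupport ν)

section InvariantMeasure

variable {X : Type*} [TopologicalSpace X]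

/-- The average of the first `n + 1` iterates of an operator, at a given point. -/
def iterAverage (Q : C(X, ℝ) →ₗ[ℝ] C(X, ℝ)) (n : ℕ) (ψ : C(X, ℝ)) (p : X) : ℝ :=
  ((n : ℝ) + 1)⁻¹ * ∑ i ∈ Finset.range (n + 1), (Q ^ i) ψ p

variable {Q : C(X, ℝ) →ₗ[ℝ] C(X, ℝ)}

lemma pow_apply_nonneg (hpos : ∀ ψ : C(X, ℝ), 0 ≤ ψ → 0 ≤ Q ψ) {ψ : C(X, ℝ)} (hψ : 0 ≤ ψ)
    (i : ℕ) : 0 ≤ (Q ^ i) ψ := by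
  induction i with
  | zero => simpa using hψ
  | succ i ih =>
    rw [pow_succ']
    exact hpos _ ih

lemma pow_apply_one (hone : Q 1 = 1) (i : ℕ) : (Q ^ i) (1 : C(X, ℝ)) = 1 := by
  induction i with
  | zero => simp
  | succ i ih => rw [pow_succ', Module.End.mul_apply, ih, hone]

lemma iterAverage_nonneg (hpos : ∀ ψ : C(X, ℝ), 0 ≤ ψ → 0 ≤ Q ψ) {ψ : C(X, ℝ)} (hψ : 0 ≤ ψ)
    (n : ℕ) (p : X) : 0 ≤ iterAverage Q n ψ p :=
  mul_nonneg (by positivity) (Finset.sum_nonneg fun i _ => pow_apply_nonneg hpos hψ i p)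

lemma iterAverage_one (hone : Q 1 = 1) (n : ℕ) (p : X) : iterAverage Q n 1 p = 1 := by
  have : (n : ℝ) + 1 ≠ 0 := by positivity
  simp [iterAverage, pow_apply_one hone, this]

lemma iterAverage_add (n : ℕ) (ψ χ : C(X, ℝ)) (p : X) :
    iterAverage Q n (ψ + χ) p = iterAverage Q n ψ p + iterAverage Q n χ p := by
  simp [iterAverage, Finset.sum_add_distrib, mul_add]

lemma iterAverage_smul (n : ℕ) (a : ℝ) (ψ : C(X, ℝ)) (p : X) :
    iterAverage Q n (a • ψ) p = a * iterAverage Q n ψ p := by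
  simp only [iterAverage, map_smul, ContinuousMap.smul_apply, smul_eq_mul, ← Finset.mul_sum]
  ring

lemma abs_apply_le_norm [CompactSpace X] (hpos : ∀ ψ : C(X, ℝ), 0 ≤ ψ → 0 ≤ Q ψ)
    (hone : Q 1 = 1) (ψ : C(X, ℝ)) (p : X) : |Q ψ p| ≤ ‖ψ‖ := by
  have h : ∀ s : ℝ, |s| ≤ 1 → s * Q ψ p ≤ ‖ψ‖ := by
    intro s hs
    have h0 : (0 : C(X, ℝ)) ≤ ‖ψ‖ • (1 : C(X, ℝ)) + (-s) • ψ := by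
      intro q
      have h1 : |s * ψ q| ≤ 1 * ‖ψ‖ := by
        rw [abs_mul]
        exact mul_le_mul hs (ψ.norm_coe_le_norm q) (abs_nonneg _) zero_le_one
      have h2 := (abs_le.1 h1).2
      simp
      linarith
    have h3 := hpos _ h0 p
    rw [map_add, map_smul, map_smul, hone] at h3
    simp at h3
    linarith
  have h1 := h 1 (by simp)
  have h2 := h (-1) (by simp)
  exact abs_le.2 ⟨by linarith, by linarith⟩

lemma abs_pow_apply_le_norm [CompactSpace X] (hpos : ∀ ψ : C(X, ℝ), 0 ≤ ψ → 0 ≤ Q ψ)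
    (hone : Q 1 = 1) (i : ℕ) (ψ : C(X, ℝ)) (p : X) : |(Q ^ i) ψ p| ≤ ‖ψ‖ :=
  abs_apply_le_norm (fun _ hψ => pow_apply_nonneg hpos hψ i) (pow_apply_one hone i) ψ p

lemma abs_iterAverage_le [CompactSpace X] (hpos : ∀ ψ : C(X, ℝ), 0 ≤ ψ → 0 ≤ Q ψ)
    (hone : Q 1 = 1) (n : ℕ) (ψ : C(X, ℝ)) (p : X) : |iterAverage Q n ψ p| ≤ ‖ψ‖ := by
  have h1 : |∑ i ∈ Finset.range (n + 1), (Q ^ i) ψ p| ≤ ((n : ℝ) + 1) * ‖ψ‖ := by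
    refine (Finset.abs_sum_le_sum_abs _ _).trans
      ((Finset.sum_le_card_nsmul _ _ ‖ψ‖ fun i _ => abs_pow_apply_le_norm hpos hone i ψ p).trans ?_)
    simp
  rw [iterAverage, abs_mul, abs_of_nonneg (by positivity : (0 : ℝ) ≤ ((n : ℝ) + 1)⁻¹),
    inv_mul_le_iff₀ (by positivity)]
  exact h1

lemma iterAverage_apply_sub (n : ℕ) (ψ : C(X, ℝ)) (p : X) :
    iterAverage Q n (Q ψ) p - iterAverage Q n ψ p =
      ((n : ℝ) + 1)⁻¹ * ((Q ^ (n + 1)) ψ p - ψ p) := by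
  rw [iterAverage, iterAverage, ← mul_sub, ← Finset.sum_sub_distrib]
  congr 1
  have : ∀ i, (Q ^ i) (Q ψ) p = (Q ^ (i + 1)) ψ p := fun i => by
    rw [pow_succ, Module.End.mul_apply]
  simp only [this]
  exact Finset.sum_range_sub (fun i => (Q ^ i) ψ p) (n + 1)

/-- Weak limits of averages along iterates of a Markov operator are invariant measures. -/
lemma exists_invariant_measure [CompactSpace X] [T2Space X] [MeasurableSpace X] [BorelSpace X]
    (hpos : ∀ ψ : C(X, ℝ), 0 ≤ ψ → 0 ≤ Q ψ) (hone : Q 1 = 1) (p : ℕ → X)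
    (φ : C(X, ℝ)) (c δ : ℝ) (h : ∀ n, δ ≤ |iterAverage Q n φ (p n) - c|) :
    ∃ lam : Measure X, IsProbabilityMeasure lam ∧ (∀ ψ : C(X, ℝ), ∫ x, Q ψ x ∂lam = ∫ x, ψ x ∂lam)
      ∧ δ ≤ |∫ x, φ x ∂lam - c| := by
  have hlim : ∀ ψ : C(X, ℝ), ∃ l : ℝ,
      Tendsto (fun n => iterAverage Q n ψ (p n)) (hyperfilter ℕ : Filter ℕ) (𝓝 l) := by
    intro ψ
    have hb : ((hyperfilter ℕ).map fun n => iterAverage Q n ψ (p n) : Filter ℝ) ≤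
        𝓟 (Set.Icc (-‖ψ‖) ‖ψ‖) := by
      rw [le_principal_iff]
      exact mem_map.2 (univ_mem' fun n => abs_le.1 (abs_iterAverage_le hpos hone n ψ (p n)))
    obtain ⟨l, -, hl⟩ := isCompact_Icc.ultrafilter_le_nhds _ hb
    exact ⟨l, hl⟩
  choose L hL using hlim
  have hadd : ∀ ψ χ, L (ψ + χ) = L ψ + L χ := fun ψ χ =>
    tendsto_nhds_unique (hL (ψ + χ)) (((hL ψ).add (hL χ)).congr fun n =>
      (iterAverage_add n ψ χ _).symm)
  have hsmul : ∀ (a : ℝ) ψ, L (a • ψ) = a * L ψ := fun a ψ =>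
    tendsto_nhds_unique (hL (a • ψ)) (((hL ψ).const_mul a).congr fun n =>
      (iterAverage_smul n a ψ _).symm)
  have hnonneg : ∀ ψ, 0 ≤ ψ → 0 ≤ L ψ := fun ψ hψ =>
    ge_of_tendsto' (hL ψ) fun n => iterAverage_nonneg hpos hψ n _
  have hL1 : L 1 = 1 := tendsto_nhds_unique (hL 1)
    (tendsto_const_nhds.congr fun n => (iterAverage_one hone n _).symm)
  have hinv : ∀ ψ, L (Q ψ) = L ψ := by
    intro ψ
    have h1 := (hL (Q ψ)).sub (hL ψ)
    have h2 : Tendsto (fun n : ℕ => ((n : ℝ) + 1)⁻¹ * (2 * ‖ψ‖)) atTop (𝓝 0) := by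
      simpa using (tendsto_one_div_add_atTop_nhds_zero_nat (𝕜 := ℝ)).mul_const (2 * ‖ψ‖)
    have h3 : Tendsto (fun n => iterAverage Q n (Q ψ) (p n) - iterAverage Q n ψ (p n))
        atTop (𝓝 0) := by
      refine squeeze_zero_norm (fun n => ?_) h2
      rw [iterAverage_apply_sub, norm_mul, Real.norm_of_nonneg (by positivity)]
      gcongr
      refine (norm_sub_le _ _).trans ?_
      have h4 := abs_pow_apply_le_norm hpos hone (n + 1) ψ (p n)
      have h5 := ψ.norm_coe_le_norm (p n)
      rw [← Real.norm_eq_abs] at h4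
      linarith
    have h6 := tendsto_nhds_unique h1 (h3.mono_left Nat.hyperfilter_le_atTop)
    linarith
  let Λ : CompactlySupportedContinuousMap X ℝ →ₚ[ℝ] ℝ :=
  { toFun g := L g.toContinuousMap
    map_add' g g' := hadd _ _
    map_smul' a g := hsmul _ _
    monotone' g g' hgg' := by
      have h1 : (0 : C(X, ℝ)) ≤ g'.toContinuousMap + (-1 : ℝ) • g.toContinuousMap := by
        intro x
        have := hgg' x
        simpa using this
      have h2 := hnonneg _ h1
      rw [hadd, hsmul] at h2
      linarith }
  have hintegral : ∀ ψ : C(X, ℝ), ∫ x, ψ x ∂(RealRMK.rieszMeasure Λ) = L ψ := fun ψ =>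
    RealRMK.integral_rieszMeasure Λ ⟨ψ, HasCompactSupport.of_compactSpace _⟩
  refine ⟨RealRMK.rieszMeasure Λ, ?_, fun ψ => by rw [hintegral, hintegral, hinv], ?_⟩
  · have h1 := hintegral 1
    rw [hL1] at h1
    simp only [ContinuousMap.one_apply, integral_const, smul_eq_mul, mul_one] at h1
    refine ⟨?_⟩
    rw [measureReal_def, ENNReal.toReal_eq_one_iff] at h1
    exact h1
  · rw [hintegral]
    exact ge_of_tendsto' ((hL φ).sub_const c).abs h

/-- If all invariant measures give `φ` the same integral `c`, then `φ - c` is uniformly close to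
a coboundary. -/
lemma exists_corrector [CompactSpace X] [T2Space X] [MeasurableSpace X] [BorelSpace X]
    (hpos : ∀ ψ : C(X, ℝ), 0 ≤ ψ → 0 ≤ Q ψ) (hone : Q 1 = 1) (φ : C(X, ℝ)) (c : ℝ)
    (h : ∀ lam : Measure X, IsProbabilityMeasure lam →
      (∀ ψ : C(X, ℝ), ∫ x, Q ψ x ∂lam = ∫ x, ψ x ∂lam) → ∫ x, φ x ∂lam = c)
    {δ : ℝ} (hδ : 0 < δ) :
    ∃ w : C(X, ℝ), ∀ p, |φ p + Q w p - w p - c| < δ := by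
  obtain ⟨n, hn⟩ : ∃ n, ∀ p, |iterAverage Q n φ p - c| < δ := by
    by_contra! hcon
    choose p hp using hcon
    obtain ⟨lam, h1, h2, h3⟩ := exists_invariant_measure hpos hone p φ c δ hp
    rw [h lam h1 h2] at h3
    simp at h3
    linarith
  have htel : ∀ i, Q (∑ j ∈ Finset.range i, (Q ^ j) φ) - ∑ j ∈ Finset.range i, (Q ^ j) φ =
      (Q ^ i) φ - φ := by
    intro i
    rw [map_sum, ← Finset.sum_sub_distrib]
    have := Finset.sum_range_sub (fun j => (Q ^ j) φ) i
    simpa [pow_succ'] using this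
  refine ⟨((n : ℝ) + 1)⁻¹ • ∑ i ∈ Finset.range (n + 1), ∑ j ∈ Finset.range i, (Q ^ j) φ,
    fun p => ?_⟩
  set w := ((n : ℝ) + 1)⁻¹ • ∑ i ∈ Finset.range (n + 1), ∑ j ∈ Finset.range i, (Q ^ j) φ with hw
  have h1 : Q w - w = ((n : ℝ) + 1)⁻¹ • ∑ i ∈ Finset.range (n + 1), ((Q ^ i) φ - φ) := by
    rw [hw, map_smul, ← smul_sub, map_sum, ← Finset.sum_sub_distrib]
    simp only [htel]
  have h2 : Q w p - w p = iterAverage Q n φ p - φ p := by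
    have h3 := congrArg (fun ψ : C(X, ℝ) => ψ p) h1
    simp only [ContinuousMap.sub_apply, ContinuousMap.smul_apply, ContinuousMap.sum_apply,
      Finset.sum_sub_distrib, smul_eq_mul, Finset.sum_const, Finset.card_range,
      nsmul_eq_mul] at h3
    rw [h3, iterAverage, mul_sub]
    congr 1
    have h5 : (((n + 1 : ℕ) : C(X, ℝ)) * φ) p = ((n : ℝ) + 1) * φ p := by simp
    rw [h5]
    field_simp
  have h4 : φ p + Q w p - w p - c = iterAverage Q n φ p - c := by linarith
  rw [h4]
  exact hn p

end InvariantMeasure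

section Concentration

variable {S P : Type*} [TopologicalSpace S] [TopologicalSpace P]

/-- The state reached from `x` after `n` steps of the random dynamics `f`. -/
def pathState (f : C(S × P, P)) (x : P) : (n : ℕ) → (Fin n → S) → P
  | 0, _ => x
  | n + 1, b => f (b (Fin.last n), pathState f x n (Fin.init b))

/-- The sum of an observable `D` along the first `n` steps of the random dynamics `f`. -/
def pathSum (f : C(S × P, P)) (D : C(S × P, ℝ)) (x : P) : (n : ℕ) → (Fin n → S) → ℝ
  | 0, _ => 0
  | n + 1, b => pathSum f D x n (Fin.init b) + D (b (Fin.last n), pathState f x n (Fin.init b))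

lemma continuous_finInit (n : ℕ) : Continuous fun b : Fin (n + 1) → S => (Fin.init b : Fin n → S) :=
  continuous_pi fun i => continuous_apply i.castSucc

lemma continuous_pathState (f : C(S × P, P)) (x : P) (n : ℕ) : Continuous (pathState f x n) := by
  induction n with
  | zero => exact continuous_const
  | succ n ih =>
    exact f.continuous.comp ((continuous_apply _).prodMk (ih.comp (continuous_finInit n)))

lemma continuous_pathSum (f : C(S × P, P)) (D : C(S × P, ℝ)) (x : P) (n : ℕ) :
    Continuous (pathSum f D x n) := by
  induction n with
  | zero => exact continuous_const
  | succ n ih =>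
    exact (ih.comp (continuous_finInit n)).add (D.continuous.comp ((continuous_apply _).prodMk
      ((continuous_pathState f x n).comp (continuous_finInit n))))

variable [CompactSpace S] [MeasurableSpace S] [BorelSpace S]

lemma integrable_of_continuous (m : Measure S) [IsFiniteMeasure m] {h : S → ℝ}
    (hh : Continuous h) : Integrable h m :=
  hh.integrable_of_hasCompactSupport (HasCompactSupport.of_compactSpace h)

lemma lintegral_exp_le (m : Measure S) [IsProbabilityMeasure m] {h : S → ℝ} (hh : Continuous h)
    (h0 : ∫ s, h s ∂m = 0) {K t : ℝ} (hK : ∀ s, |h s| ≤ K) (ht : |t| * K ≤ 1) :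
    ∫⁻ s, ENNReal.ofReal (Real.exp (t * h s)) ∂m ≤ ENNReal.ofReal (Real.exp (t ^ 2 * K ^ 2)) := by
  have hpt : ∀ s, Real.exp (t * h s) ≤ 1 + t * h s + t ^ 2 * K ^ 2 := by
    intro s
    have h1 : |t * h s| ≤ |t| * K := by
      rw [abs_mul]
      exact mul_le_mul_of_nonneg_left (hK s) (abs_nonneg t)
    have h2 := (abs_le.1 (Real.abs_exp_sub_one_sub_id_le (h1.trans ht))).2
    have h3 : (t * h s) ^ 2 ≤ (|t| * K) ^ 2 := sq_le_sq' (by linarith [(abs_le.1 h1).1])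
      (abs_le.1 h1).2
    rw [mul_pow |t|, sq_abs] at h3
    linarith
  have hintegral : Integrable (fun s => 1 + t * h s + t ^ 2 * K ^ 2) m :=
    integrable_of_continuous m (by fun_prop)
  calc ∫⁻ s, ENNReal.ofReal (Real.exp (t * h s)) ∂m
      ≤ ∫⁻ s, ENNReal.ofReal (1 + t * h s + t ^ 2 * K ^ 2) ∂m :=
        lintegral_mono fun s => ENNReal.ofReal_le_ofReal (hpt s)
    _ = ENNReal.ofReal (∫ s, (1 + t * h s + t ^ 2 * K ^ 2) ∂m) :=
        (ofReal_integral_eq_lintegral_ofReal hintegral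
          (ae_of_all _ fun s => (Real.exp_pos _).le.trans (hpt s))).symm
    _ ≤ ENNReal.ofReal (Real.exp (t ^ 2 * K ^ 2)) := by
        apply ENNReal.ofReal_le_ofReal
        have hI : Integrable (fun s => t * h s) m := integrable_of_continuous m (by fun_prop)
        have h1 : ∫ s, (1 + t * h s + t ^ 2 * K ^ 2) ∂m =
            (∫ _, (1 : ℝ) ∂m + ∫ s, t * h s ∂m) + ∫ _, t ^ 2 * K ^ 2 ∂m := by
          rw [← integral_add (integrable_const _) hI]
          exact integral_add ((integrable_const _).add hI) (integrable_const _)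
        rw [h1, integral_const_mul, h0]
        simp only [integral_const, probReal_univ, smul_eq_mul, one_mul, mul_zero, add_zero]
        linarith [Real.add_one_le_exp (t ^ 2 * K ^ 2)]

/-- Exponential moment bound for the martingale `pathSum f D x n`. -/
lemma lintegral_exp_pathSum_le [SecondCountableTopology S] (m : Measure S) [IsProbabilityMeasure m] (f : C(S × P, P))
    (D : C(S × P, ℝ)) (x : P) (h0 : ∀ y, ∫ s, D (s, y) ∂m = 0) {K t : ℝ} (hK : ∀ p, |D p| ≤ K)
    (ht : |t| * K ≤ 1) (n : ℕ) :
    ∫⁻ b, ENNReal.ofReal (Real.exp (t * pathSum f D x n b)) ∂(Measure.pi fun _ : Fin n => m) ≤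
      ENNReal.ofReal (Real.exp (n * (t ^ 2 * K ^ 2))) := by
  induction n with
  | zero => simp [pathSum]
  | succ n ih =>
    have hmp := (measurePreserving_piFinSuccAbove (fun _ : Fin (n + 1) => m) (Fin.last n)).symm
    rw [← hmp.lintegral_comp_emb (MeasurableEquiv.measurableEmbedding _)]
    have hval : ∀ q : S × (Fin n → S),
        ENNReal.ofReal (Real.exp (t * pathSum f D x (n + 1)
          ((MeasurableEquiv.piFinSuccAbove (fun _ => S) (Fin.last n)).symm q))) =
        ENNReal.ofReal (Real.exp (t * D (q.1, pathState f x n q.2))) *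
          ENNReal.ofReal (Real.exp (t * pathSum f D x n q.2)) := by
      rintro ⟨s, b⟩
      have h1 : (MeasurableEquiv.piFinSuccAbove (fun _ => S) (Fin.last n)).symm (s, b) =
          (Fin.snoc b s : Fin (n + 1) → S) := by
        simp [MeasurableEquiv.piFinSuccAbove, Fin.insertNthEquiv, Fin.insertNth_last']
      rw [h1, ← ENNReal.ofReal_mul (Real.exp_pos _).le, ← Real.exp_add]
      simp only [pathSum, Fin.init_snoc, Fin.snoc_last]
      congr 2
      ring
    simp only [hval]
    have hc1 : Continuous fun q : S × (Fin n → S) =>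
        ENNReal.ofReal (Real.exp (t * D (q.1, pathState f x n q.2))) := by
      have := continuous_pathState f x n
      exact ENNReal.continuous_ofReal.comp (by fun_prop)
    have hc2 : Continuous fun b : Fin n → S => ENNReal.ofReal (Real.exp (t * pathSum f D x n b)) := by
      have := continuous_pathSum f D x n
      exact ENNReal.continuous_ofReal.comp (by fun_prop)
    have hm : Measurable fun q : S × (Fin n → S) =>
        ENNReal.ofReal (Real.exp (t * D (q.1, pathState f x n q.2))) *
          ENNReal.ofReal (Real.exp (t * pathSum f D x n q.2)) :=
      hc1.measurable.mul (hc2.comp continuous_snd).measurable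
    rw [lintegral_prod_symm' _ hm]
    calc ∫⁻ b, ∫⁻ s, ENNReal.ofReal (Real.exp (t * D (s, pathState f x n b))) *
          ENNReal.ofReal (Real.exp (t * pathSum f D x n b)) ∂m ∂(Measure.pi fun _ : Fin n => m)
        ≤ ∫⁻ b, ENNReal.ofReal (Real.exp (t ^ 2 * K ^ 2)) *
          ENNReal.ofReal (Real.exp (t * pathSum f D x n b)) ∂(Measure.pi fun _ : Fin n => m) := by
          refine lintegral_mono fun b => ?_
          rw [lintegral_mul_const' _ _ ENNReal.ofReal_ne_top]
          gcongr
          exact lintegral_exp_le m (by fun_prop) (h0 _) (fun s => hK _) ht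
      _ ≤ ENNReal.ofReal (Real.exp (t ^ 2 * K ^ 2)) *
          ENNReal.ofReal (Real.exp (n * (t ^ 2 * K ^ 2))) := by
          rw [lintegral_const_mul' _ _ ENNReal.ofReal_ne_top]
          gcongr
      _ = ENNReal.ofReal (Real.exp ((n + 1 : ℕ) * (t ^ 2 * K ^ 2))) := by
          rw [← ENNReal.ofReal_mul (Real.exp_pos _).le, ← Real.exp_add]
          congr 2
          push_cast
          ring

lemma measure_pathSum_ge_le [SecondCountableTopology S] (m : Measure S) [IsProbabilityMeasure m] (μ : Measure (ℕ → S))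
    (hμ : ∀ n : ℕ, μ.map (fun g (i : Fin n) => g (i : ℕ)) = Measure.pi fun _ : Fin n => m)
    (f : C(S × P, P)) (D : C(S × P, ℝ)) (x : P) (h0 : ∀ y, ∫ s, D (s, y) ∂m = 0) {K t : ℝ}
    (hK : ∀ p, |D p| ≤ K) (ht : |t| * K ≤ 1) (n : ℕ) (a : ℝ) :
    μ {g | a ≤ t * pathSum f D x n fun i => g i} ≤
      ENNReal.ofReal (Real.exp (n * (t ^ 2 * K ^ 2) - a)) := by
  have hr : Measurable fun (g : ℕ → S) (i : Fin n) => g (i : ℕ) :=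
    measurable_pi_lambda _ fun i => measurable_pi_apply _
  have hF : Measurable fun b : Fin n → S => ENNReal.ofReal (Real.exp (t * pathSum f D x n b)) := by
    have := continuous_pathSum f D x n
    exact (ENNReal.continuous_ofReal.comp (by fun_prop)).measurable
  have h1 := lintegral_exp_pathSum_le m f D x h0 hK ht n
  rw [← hμ n, lintegral_map hF hr] at h1
  have h2 := mul_meas_ge_le_lintegral (μ := μ) (hF.comp hr) (ENNReal.ofReal (Real.exp a))
  have hset : {g : ℕ → S | a ≤ t * pathSum f D x n fun i => g i} ⊆
      {g | ENNReal.ofReal (Real.exp a) ≤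
        ENNReal.ofReal (Real.exp (t * pathSum f D x n fun i => g i))} :=
    fun g hg => ENNReal.ofReal_le_ofReal (Real.exp_le_exp.2 hg)
  calc μ {g | a ≤ t * pathSum f D x n fun i => g i}
      = ENNReal.ofReal (Real.exp (-a)) * (ENNReal.ofReal (Real.exp a) *
          μ {g | a ≤ t * pathSum f D x n fun i => g i}) := by
        rw [← mul_assoc, ← ENNReal.ofReal_mul (Real.exp_pos _).le, ← Real.exp_add]
        simp
    _ ≤ ENNReal.ofReal (Real.exp (-a)) * ENNReal.ofReal (Real.exp (n * (t ^ 2 * K ^ 2))) := by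
        gcongr
        exact (mul_le_mul_right (measure_mono hset) _).trans (h2.trans h1)
    _ = ENNReal.ofReal (Real.exp (n * (t ^ 2 * K ^ 2) - a)) := by
        rw [← ENNReal.ofReal_mul (Real.exp_pos _).le, ← Real.exp_add]
        congr 2
        ring

/-- The average of `ψ (s, f (s, x))` over `s`, as a continuous function of `x`. -/
def stepMean [FirstCountableTopology P] (m : Measure S) [IsProbabilityMeasure m]
    [CompactSpace P] (f : C(S × P, P)) (ψ : C(S × P, ℝ)) : C(P, ℝ) where
  toFun x := ∫ s, ψ (s, f (s, x)) ∂m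
  continuous_toFun := by
    refine continuous_of_dominated (bound := fun _ => ‖ψ‖)
      (fun x => Continuous.aestronglyMeasurable (by fun_prop))
      (fun x => ae_of_all _ fun s => ψ.norm_coe_le_norm _) (integrable_const _)
      (ae_of_all _ fun s => by fun_prop)

/-- The Markov operator on `C(S × P)` of the chain of pairs (last step, current state). -/
def stepOp [FirstCountableTopology P] (m : Measure S) [IsProbabilityMeasure m]
    [CompactSpace P] (f : C(S × P, P)) : C(S × P, ℝ) →ₗ[ℝ] C(S × P, ℝ) where
  toFun ψ := (stepMean m f ψ).comp ⟨Prod.snd, continuous_snd⟩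
  map_add' ψ χ := by
    ext p
    exact integral_add (integrable_of_continuous m (by fun_prop))
      (integrable_of_continuous m (by fun_prop))
  map_smul' a ψ := by
    ext p
    exact integral_const_mul a _

variable [CompactSpace P] [FirstCountableTopology P]
  (m : Measure S) [IsProbabilityMeasure m] (f : C(S × P, P))

lemma stepOp_apply (ψ : C(S × P, ℝ)) (p : S × P) : stepOp m f ψ p = stepMean m f ψ p.2 := rfl

lemma stepOp_nonneg {ψ : C(S × P, ℝ)} (hψ : 0 ≤ ψ) : 0 ≤ stepOp m f ψ :=
  fun _ => integral_nonneg fun _ => hψ _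

lemma stepOp_one : stepOp m f 1 = 1 := by
  ext p
  simp [stepOp_apply, stepMean]

lemma abs_stepMean_le (ψ : C(S × P, ℝ)) (x : P) : |stepMean m f ψ x| ≤ ‖ψ‖ := by
  have := norm_integral_le_of_norm_le_const (μ := m)
    (ae_of_all _ fun s => ψ.norm_coe_le_norm (s, f (s, x)))
  rw [probReal_univ, mul_one] at this
  exact this

/-- The fluctuation of `w` along one step around its conditional mean. -/
def stepFluct (w : C(S × P, ℝ)) : C(S × P, ℝ) where
  toFun p := w (p.1, f p) - stepMean m f w p.2
  continuous_toFun := by fun_prop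

lemma stepFluct_apply (w : C(S × P, ℝ)) (s : S) (x : P) :
    stepFluct m f w (s, x) = w (s, f (s, x)) - stepMean m f w x := rfl

lemma integral_stepFluct (w : C(S × P, ℝ)) (x : P) : ∫ s, stepFluct m f w (s, x) ∂m = 0 := by
  simp only [stepFluct_apply]
  rw [integral_sub (integrable_of_continuous m (by fun_prop)) (integrable_const _)]
  simp [stepMean]

lemma abs_stepFluct_le (w : C(S × P, ℝ)) (p : S × P) : |stepFluct m f w p| ≤ 2 * ‖w‖ := by
  have h1 := w.norm_coe_le_norm (p.1, f p)
  have h2 := abs_stepMean_le m f w p.2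
  have h3 := abs_sub (w (p.1, f p)) (stepMean m f w p.2)
  rw [Real.norm_eq_abs] at h1
  change |w (p.1, f p) - stepMean m f w p.2| ≤ _
  linarith

/-- Approximating the Birkhoff sums of `φ` by the martingale of a corrector `w`. -/
lemma abs_sum_sub_pathSum_le {φ w : C(S × P, ℝ)} {c δ : ℝ}
    (hw : ∀ p, |φ p + stepOp m f w p - w p - c| ≤ δ) (x : P) (g : ℕ → S) (n : ℕ) :
    |∑ j ∈ Finset.range n, φ (g j, pathState f x (j + 1) fun i => g i) - n * c -
      pathSum f (stepFluct m f w) x n fun i => g i| ≤ n * δ + 2 * ‖w‖ := by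
  have key : |∑ j ∈ Finset.range n, φ (g j, pathState f x (j + 1) fun i => g i) - n * c -
      (pathSum f (stepFluct m f w) x n fun i => g i) - stepMean m f w x +
      stepMean m f w (pathState f x n fun i => g i)| ≤ n * δ := by
    induction n with
    | zero => simp [pathSum, pathState]
    | succ n ih =>
      set y := pathState f x n fun i => g i with hy
      have hstate : (pathState f x (n + 1) fun i => g i) = f (g n, y) := rfl
      have hsum : (pathSum f (stepFluct m f w) x (n + 1) fun i => g i) =
          (pathSum f (stepFluct m f w) x n fun i => g i) + (w (g n, f (g n, y)) -
            stepMean m f w y) := rfl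
      have h1 := hw (g n, f (g n, y))
      rw [stepOp_apply] at h1
      rw [Finset.sum_range_succ, hstate, hsum]
      push_cast
      rw [abs_le] at *
      constructor <;> linarith [ih.1, ih.2, h1.1, h1.2]
  have h1 := abs_le.1 (abs_stepMean_le m f w x)
  have h2 := abs_le.1 (abs_stepMean_le m f w (pathState f x n fun i => g i))
  rw [abs_le] at *
  constructor <;> linarith [key.1, key.2]

/-- Uniform large deviation estimate for Birkhoff sums. -/
lemma exists_measure_deviation_le [SecondCountableTopology S] (μ : Measure (ℕ → S))
    (hμ : ∀ n : ℕ, μ.map (fun g (i : Fin n) => g (i : ℕ)) = Measure.pi fun _ : Fin n => m)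
    {φ w : C(S × P, ℝ)} {c ε : ℝ} (hε : 0 < ε)
    (hw : ∀ p, |φ p + stepOp m f w p - w p - c| ≤ ε / 2) :
    ∃ C > (0 : ℝ), ∃ r > (0 : ℝ), ∀ (x : P) (n : ℕ),
      μ {g | n * ε ≤ |∑ j ∈ Finset.range n, φ (g j, pathState f x (j + 1) fun i => g i) - n * c|} ≤
        ENNReal.ofReal (C * Real.exp (-r * n)) := by
  set K := 2 * ‖w‖ + 1 with hKdef
  have hK1 : 0 < K := by positivity
  set t := min (1 / K) (ε / (4 * K ^ 2)) with htdef
  have ht0 : 0 < t := by positivity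
  have htK : t * K ≤ 1 := by
    have := min_le_left (1 / K) (ε / (4 * K ^ 2))
    rwa [← htdef, le_div_iff₀ hK1] at this
  have htK2 : t * K ^ 2 ≤ ε / 4 := by
    have := min_le_right (1 / K) (ε / (4 * K ^ 2))
    rw [← htdef, le_div_iff₀ (by positivity)] at this
    linarith
  have hD : ∀ p, |stepFluct m f w p| ≤ K := fun p =>
    (abs_stepFluct_le m f w p).trans (by linarith)
  refine ⟨2 * Real.exp 1, by positivity, t * ε / 4, by positivity, fun x n => ?_⟩
  set M : (ℕ → S) → ℝ := fun g => pathSum f (stepFluct m f w) x n fun i => g i with hM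
  set a := t * (n * (ε / 2) - K) with ha
  have hexp : n * (t ^ 2 * K ^ 2) - a ≤ 1 + -(t * ε / 4) * n := by
    have h1 : (n * t) * (t * K ^ 2) ≤ (n * t) * (ε / 4) :=
      mul_le_mul_of_nonneg_left htK2 (by positivity)
    rw [ha]
    linarith
  have hsub : {g | n * ε ≤
      |∑ j ∈ Finset.range n, φ (g j, pathState f x (j + 1) fun i => g i) - n * c|} ⊆
      {g | a ≤ t * M g} ∪ {g | a ≤ (-t) * M g} := by
    intro g hg
    have h1 := abs_sum_sub_pathSum_le m f hw x g n
    have h2 : n * (ε / 2) - K ≤ |M g| := by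
      have h3 := abs_sub_abs_le_abs_sub
        (∑ j ∈ Finset.range n, φ (g j, pathState f x (j + 1) fun i => g i) - n * c) (M g)
      have h4 : n * ε ≤ |∑ j ∈ Finset.range n, φ (g j, pathState f x (j + 1) fun i => g i) -
        n * c| := hg
      linarith
    have h5 : a ≤ t * |M g| := mul_le_mul_of_nonneg_left h2 ht0.le
    rcases abs_choice (M g) with h | h
    · left
      rw [h] at h5
      exact h5
    · right
      rw [h] at h5
      change a ≤ (-t) * M g
      linarith
  have hb1 := measure_pathSum_ge_le m μ hμ f (stepFluct m f w) x (integral_stepFluct m f w)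
    hD (t := t) (by rwa [abs_of_pos ht0]) n a
  have hb2 := measure_pathSum_ge_le m μ hμ f (stepFluct m f w) x (integral_stepFluct m f w)
    hD (t := -t) (by rwa [abs_neg, abs_of_pos ht0]) n a
  rw [neg_sq] at hb2
  have hb : ENNReal.ofReal (Real.exp (n * (t ^ 2 * K ^ 2) - a)) ≤
      ENNReal.ofReal (Real.exp (1 + -(t * ε / 4) * n)) :=
    ENNReal.ofReal_le_ofReal (Real.exp_le_exp.2 hexp)
  calc _ ≤ μ ({g | a ≤ t * M g} ∪ {g | a ≤ (-t) * M g}) := measure_mono hsub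
    _ ≤ μ {g | a ≤ t * M g} + μ {g | a ≤ (-t) * M g} := measure_union_le _ _
    _ ≤ ENNReal.ofReal (Real.exp (1 + -(t * ε / 4) * n)) +
        ENNReal.ofReal (Real.exp (1 + -(t * ε / 4) * n)) :=
      add_le_add (hb1.trans hb) (hb2.trans hb)
    _ = ENNReal.ofReal (2 * Real.exp 1 * Real.exp (-(t * ε / 4) * n)) := by
      rw [← ENNReal.ofReal_add (Real.exp_pos _).le (Real.exp_pos _).le, Real.exp_add]
      congr 1
      ring

end Concentration

lemma measure_iUnion_add_le_of_exp_decay {Ω : Type*} [MeasurableSpace Ω] (μ : Measure Ω)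
    {C r : ℝ} (hC : 0 ≤ C) (hr : 0 < r) (B : ℕ → Set Ω)
    (hB : ∀ n : ℕ, μ (B n) ≤ ENNReal.ofReal (C * Real.exp (-r * n))) (N : ℕ) :
    μ (⋃ k, B (N + k)) ≤
      ENNReal.ofReal (C * (1 - Real.exp (-r))⁻¹ * Real.exp (-r * N)) := by
  have h1 : Real.exp (-r) < 1 := Real.exp_lt_one_iff.2 (by linarith)
  have hgeo := (hasSum_geometric_of_lt_one (Real.exp_pos (-r)).le h1).mul_left
    (C * Real.exp (-r * N))
  have hterm : ∀ k : ℕ, C * Real.exp (-r * (N + k : ℕ)) =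
      C * Real.exp (-r * N) * Real.exp (-r) ^ k := by
    intro k
    rw [← Real.exp_nat_mul, mul_assoc, ← Real.exp_add]
    congr 2
    push_cast
    ring
  calc μ (⋃ k, B (N + k)) ≤ ∑' k, μ (B (N + k)) := measure_iUnion_le _
    _ ≤ ∑' k : ℕ, ENNReal.ofReal (C * Real.exp (-r * N) * Real.exp (-r) ^ k) :=
        ENNReal.tsum_le_tsum fun k => by
          rw [← hterm]
          exact hB _
    _ = ENNReal.ofReal (C * Real.exp (-r * N) * (1 - Real.exp (-r))⁻¹) := by
        rw [← ENNReal.ofReal_tsum_of_nonneg (fun k => by positivity) hgeo.summable,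
          hgeo.tsum_eq]
    _ = _ := by
        congr 1
        ring

/-- The projective action of the support of `ν`, as a continuous map. -/
def pactS {d : ℕ} (ν : Measure (GLd d)) : C(↥(msupport ν) × Pd d, Pd d) where
  toFun p := pact (p.1 : GLd d) p.2
  continuous_toFun := continuous_pact.comp
    ((continuous_subtype_val.comp continuous_fst).prodMk continuous_snd)

lemma pathState_pactS {d : ℕ} (ν : Measure (GLd d)) (x : Pd d) (n : ℕ) (b : Fin n → msupport ν) :
    pathState (pactS ν) x n b =
      pact ((List.ofFn fun i : Fin n => (b i : GLd d)).reverse.prod) x := by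
  induction n with
  | zero => simp [pathState, pact_one]
  | succ n ih =>
    rw [List.ofFn_succ', List.concat_eq_append, List.reverse_append, List.prod_append, pact_mul]
    simp only [pathState, ih, Fin.init]
    simp [pactS]

/-- **Corollary 4.6.** Let `ν` be a compactly supported Borel probability measure on
`G = GL(d,ℝ)` with support `S`, and `μ = ν^ℕ` the Bernoulli measure (characterized by its
finite-dimensional marginals).  Let `φ ∈ C(S × P)` be such that `∫ φ dλ = Σ(ν,φ)` for every
`Q_ν`-invariant Borel probability measure `λ`.  Then for every `ε > 0` there exist `C₃ > 0` and
`c₃ > 0` such that for every `[v] ∈ P` and `N ∈ ℕ` there is a measurable set `ℰ₃` with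
`ν^ℕ(ℰ₃ᶜ) ≤ C₃ e^{−c₃ N}` and
`Σ(ν,φ) − ε < (1/n) ∑_{j<n} φ(g_j, (g_j ⋯ g₀) • [v]) < Σ(ν,φ) + ε`
for every `𝐠 ∈ ℰ₃` and `n ≥ N`. -/
theorem stmt6 (d : ℕ) (ν : Measure (GLd d)) [IsProbabilityMeasure ν]
    (hcs : IsCompact (msupport ν))
    (μ : Measure (ℕ → ↥(msupport ν))) [IsProbabilityMeasure μ]
    (hμ : ∀ n : ℕ, μ.map (fun g (i : Fin n) => g (i : ℕ)) =
      Measure.pi fun _ : Fin n => nuS ν)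
    (φ : BoundedContinuousFunction (↥(msupport ν) × Pd d) ℝ)
    (hφ : ∀ lam : Measure (↥(msupport ν) × Pd d), IsProbabilityMeasure lam → QInv ν lam →
      ∫ p, φ p ∂lam = SigmaSup ν φ)
    (ε : ℝ) (hε : 0 < ε) :
    ∃ C > (0 : ℝ), ∃ c > (0 : ℝ), ∀ x : Pd d, ∀ N : ℕ,
      ∃ E : Set (ℕ → ↥(msupport ν)), MeasurableSet E ∧
        μ Eᶜ ≤ ENNReal.ofReal (C * Real.exp (-c * N)) ∧
        ∀ gs ∈ E, ∀ n : ℕ, N ≤ n →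
          (n : ℝ)⁻¹ * ∑ j ∈ Finset.range n,
              φ (gs j, pact ((List.ofFn fun i : Fin (j + 1) =>
                ((gs (i : ℕ) : GLd d))).reverse.prod) x) ∈
            Set.Ioo (SigmaSup ν φ - ε) (SigmaSup ν φ + ε) := by
  have : CompactSpace (msupport ν) := isCompact_iff_compactSpace.1 hcs
  have := isProbabilityMeasure_nuS ν
  obtain ⟨w, hw⟩ := exists_corrector (Q := stepOp (nuS ν) (pactS ν))
    (fun _ hψ => stepOp_nonneg (nuS ν) (pactS ν) hψ) (stepOp_one (nuS ν) (pactS ν))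
    φ.toContinuousMap (SigmaSup ν φ)
    (fun lam hlam hinv => hφ lam hlam fun ψ => hinv ψ.toContinuousMap) (half_pos hε)
  obtain ⟨C, hC, r, hr, hdev⟩ := exists_measure_deviation_le (nuS ν) (pactS ν) μ hμ hε
    fun p => (hw p).le
  have hr1 : 0 < 1 - Real.exp (-r) := sub_pos.2 (Real.exp_lt_one_iff.2 (by linarith))
  refine ⟨C * (1 - Real.exp (-r))⁻¹, by positivity, r, hr, fun x N => ?_⟩
  set B : ℕ → Set (ℕ → ↥(msupport ν)) := fun n => {g | n * ε ≤ |∑ j ∈ Finset.range n,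
    φ.toContinuousMap (g j, pathState (pactS ν) x (j + 1) fun i => g i) - n * SigmaSup ν φ|}
    with hBdef
  refine ⟨(toMeasurable μ (⋃ k, B (N + k)))ᶜ, (measurableSet_toMeasurable _ _).compl, ?_, ?_⟩
  · rw [compl_compl, measure_toMeasurable]
    exact measure_iUnion_add_le_of_exp_decay μ hC.le hr B (hdev x) N
  · intro gs hgs n hn
    have hB : gs ∉ B n := by
      intro hmem
      refine hgs (subset_toMeasurable _ _ (Set.mem_iUnion.2 ⟨n - N, ?_⟩))
      rwa [Nat.add_sub_cancel' hn]
    have hlt : |∑ j ∈ Finset.range n, φ (gs j, pact ((List.ofFn fun i : Fin (j + 1) =>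
        ((gs (i : ℕ) : GLd d))).reverse.prod) x) - n * SigmaSup ν φ| < n * ε := by
      simp only [← pathState_pactS ν x _ fun i => gs i]
      exact not_le.1 hB
    have hn0 : (0 : ℝ) < n := pos_of_mul_pos_left ((abs_nonneg _).trans_lt hlt) hε.le
    rw [abs_lt] at hlt
    rw [Set.mem_Ioo, lt_inv_mul_iff₀ hn0, inv_mul_lt_iff₀ hn0]
    constructor <;> linarith [hlt.1, hlt.2]

end
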